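/- Let G be a graph with minimum degree three and let E(A,B) be a k-edge-cut of G with |A| ≥ k − 1 and |B| ≥ k − 1. Then E(A,B) is a cyclic edge-cut, i.e., both induced subgraphs G[A] and G[B] contain a cycle. -/

import Mathlib

open scoped Classical

noncomputable section

/-- A finite multigraph: finitely many vertices and edges, each edge has an
unordered pair of endpoints (parallel edges and loops are allowed). -/
structure Multigraph where
  V : Type
  E : Type
  fintypeV : Fintype V := by infer_instance
  fintypeE : Fintype E := by infer_instance
  ends : E → Sym2 V

namespace Multigraph

instance (G : Multigraph) : Fintype G.V := G.fintypeV
instance (G : Multigraph) : Fintype G.E := G.fintypeE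

/-- The number of endpoints of the edge `e` that are equal to `v`
(a loop at `v` counts twice). -/
def inc (G : Multigraph) (v : G.V) (e : G.E) : ℕ :=
  if G.ends e = Sym2.diag v then 2 else if v ∈ G.ends e then 1 else 0

/-- The degree of a vertex: the number of edge-ends at it (loops count twice). -/
def degree (G : Multigraph) (v : G.V) : ℕ := ∑ e : G.E, G.inc v e

/-- A graph is cubic if every vertex has degree three. -/
def IsCubic (G : Multigraph) : Prop := ∀ v : G.V, G.degree v = 3

/-- A perfect matching: a set of (non-loop) edges such that every vertex is
incident with exactly one edge of the set. -/
def IsPerfectMatching (G : Multigraph) (M : Finset G.E) : Prop :=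
  (∀ e ∈ M, ¬ (G.ends e).IsDiag) ∧
  ∀ v : G.V, ∃! e, e ∈ M ∧ v ∈ G.ends e

/-- The number of perfect matchings of `G`. -/
def pmCount (G : Multigraph) : ℕ :=
  Nat.card {M : Finset G.E // G.IsPerfectMatching M}

/-- Every edge lies in some perfect matching. -/
def MatchingCovered (G : Multigraph) : Prop :=
  ∀ e : G.E, ∃ M, G.IsPerfectMatching M ∧ e ∈ M

/-- Every edge lies in at least two perfect matchings. -/
def MatchingDoubleCovered (G : Multigraph) : Prop :=
  ∀ e : G.E, 2 ≤ Nat.card {M : Finset G.E // G.IsPerfectMatching M ∧ e ∈ M}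

/-- Adjacency via some edge. -/
def Adj (G : Multigraph) (u v : G.V) : Prop := ∃ e : G.E, G.ends e = s(u, v)

/-- The graph is connected. -/
def Connected (G : Multigraph) : Prop :=
  Nonempty G.V ∧ ∀ u v : G.V, Relation.ReflTransGen G.Adj u v

/-- The edge-cut `E(A, Aᶜ)`: edges with one end in `A` and the other outside. -/
def cutEdges (G : Multigraph) (A : Set G.V) : Set G.E :=
  {e | ∃ u v, G.ends e = s(u, v) ∧ u ∈ A ∧ v ∉ A}

/-- `G` is `k`-edge-connected: no edge-cut has fewer than `k` edges. -/
def EdgeConnected (G : Multigraph) (k : ℕ) : Prop :=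
  ∀ A : Set G.V, A.Nonempty → A ≠ Set.univ → k ≤ (G.cutEdges A).ncard

/-- Bridgeless = 2-edge-connected: connected with no edge-cut of size `< 2`. -/
def Bridgeless (G : Multigraph) : Prop := G.Connected ∧ G.EdgeConnected 2

/-- The subgraph induced on `A` contains a cycle (two parallel edges count as a
cycle of length two): there is a nonempty set of edges inside `A` in which every
vertex is incident with zero or at least two edge-ends. -/
def HasCycleWithin (G : Multigraph) (A : Set G.V) : Prop :=
  ∃ F : Finset G.E, F.Nonempty ∧ (∀ e ∈ F, ∀ v ∈ G.ends e, v ∈ A) ∧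
    ∀ v : G.V, (∑ e ∈ F, G.inc v e) ≠ 1

/-- The edge-cut `E(A, Aᶜ)` is cyclic: both sides contain a cycle. -/
def IsCyclicCut (G : Multigraph) (A : Set G.V) : Prop :=
  G.HasCycleWithin A ∧ G.HasCycleWithin Aᶜ

/-- `G` is cyclically `k`-edge-connected: no cyclic edge-cut has fewer than `k` edges. -/
def CyclicallyEdgeConnected (G : Multigraph) (k : ℕ) : Prop :=
  ∀ A : Set G.V, G.IsCyclicCut A → k ≤ (G.cutEdges A).ncard

/-- A cut is tight: every perfect matching contains exactly one of its edges. -/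
def IsTightCut (G : Multigraph) (A : Set G.V) : Prop :=
  ∀ M : Finset G.E, G.IsPerfectMatching M →
    (M.filter (fun e => e ∈ G.cutEdges A)).card = 1

/-- Adjacency within a set `A` of vertices. -/
def AdjOn (G : Multigraph) (A : Set G.V) (u v : G.V) : Prop :=
  u ∈ A ∧ v ∈ A ∧ G.Adj u v

/-- The subgraph induced on `A` is connected (any two of its vertices are joined
by a walk inside `A`). -/
def ConnectedOn (G : Multigraph) (A : Set G.V) : Prop :=
  ∀ u ∈ A, ∀ v ∈ A, Relation.ReflTransGen (G.AdjOn A) u v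

/-- `G` is `k`-vertex-connected: it has at least `k+1` vertices and removing any
set of at most `k-1` vertices leaves it connected. -/
def VertexConnected (G : Multigraph) (k : ℕ) : Prop :=
  k + 1 ≤ Fintype.card G.V ∧
  ∀ T : Set G.V, T.ncard ≤ k - 1 → G.ConnectedOn Tᶜ

/-- `{x, y}` is a 2-vertex-cut: removing both vertices disconnects the graph. -/
def IsVertexCutPair (G : Multigraph) (x y : G.V) : Prop :=
  x ≠ y ∧ ¬ G.ConnectedOn ({x, y}ᶜ)

/-- `G` is bipartite: the vertices split into two classes so that each edge
joins the two classes. -/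
def Bipartite (G : Multigraph) : Prop :=
  ∃ X : Set G.V, ∀ e : G.E, ∃ u v, G.ends e = s(u, v) ∧ u ∈ X ∧ v ∉ X

/-- Delete a set of edges (keeping all vertices). -/
def deleteEdges (G : Multigraph) (F : Set G.E) : Multigraph where
  V := G.V
  E := {e : G.E // e ∉ F}
  ends e := G.ends e.1

/-- Contract the vertex set `A` to a single vertex (`none`), deleting the arising
loops and keeping parallel edges. -/
def contract (G : Multigraph) (A : Set G.V) : Multigraph where
  V := Option {x : G.V // x ∉ A}
  E := {e : G.E // ¬ ∀ v ∈ G.ends e, v ∈ A}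
  ends e := (G.ends e.1).map fun x => if h : x ∈ A then none else some ⟨x, h⟩

/-- Isomorphism of multigraphs. -/
def Iso (G₁ G₂ : Multigraph) : Prop :=
  ∃ (f : G₁.V ≃ G₂.V) (g : G₁.E ≃ G₂.E), ∀ e, G₂.ends (g e) = (G₁.ends e).map f

/-- The complete graph on four vertices. -/
def K4 : Multigraph where
  V := Fin 4
  E := {p : Fin 4 × Fin 4 // p.1 < p.2}
  ends p := s(p.1.1, p.1.2)

/-- The result of simultaneously replacing every vertex of `S` by a triangle;
`σ e v` records to which of the three triangle vertices at `v` the edge `e`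
(formerly ending at `v`) is attached. -/
def expandTriangles (H : Multigraph) (S : Set H.V) (σ : H.E → H.V → Fin 3) :
    Multigraph where
  V := {x : H.V // x ∉ S} ⊕ (S × Fin 3)
  E := H.E ⊕ (S × Fin 3)
  ends e :=
    match e with
    | Sum.inl e => (H.ends e).map fun x =>
        if h : x ∈ S then Sum.inr (⟨x, h⟩, σ e x) else Sum.inl ⟨x, h⟩
    | Sum.inr (w, i) => s(Sum.inr (w, i + 1), Sum.inr (w, i + 2))

/-- `G` is obtained from `H` by replacing each vertex of `S` with a triangle:
the three edges formerly incident with a vertex of `S` get attached to the three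
distinct new triangle vertices. -/
def IsTriangleExpansion (H : Multigraph) (S : Set H.V) (G : Multigraph) : Prop :=
  ∃ σ : H.E → H.V → Fin 3,
    (∀ v ∈ S, ∀ e : H.E, H.ends e ≠ Sym2.diag v) ∧
    (∀ v ∈ S, Set.InjOn (fun e => σ e v) {e : H.E | v ∈ H.ends e}) ∧
    Iso (expandTriangles H S σ) G

/-- Klee-graphs: `K₄` together with everything obtainable by repeatedly replacing
a vertex with a triangle. -/
inductive IsKlee : Multigraph → Prop
  | k4 (G : Multigraph) : Iso K4 G → IsKlee G
  | expand (G : Multigraph) (v : G.V) (H : Multigraph) :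
      IsKlee G → IsTriangleExpansion G {v} H → IsKlee H

/-- A nice 3-edge-cut (of a cubic graph). -/
def IsNiceCut (G : Multigraph) (A : Set G.V) : Prop :=
  A.Nonempty ∧ A ≠ Set.univ ∧ (G.cutEdges A).ncard = 3 ∧
  ¬ IsKlee (G.contract A) ∧
  (¬ IsKlee (G.contract Aᶜ) ∨
   9 ≤ A.ncard ∨
   (5 ≤ A.ncard ∧ ¬ G.IsTightCut A) ∨
   (A.ncard = 3 ∧
     2 ≤ Nat.card {M : Finset G.E // G.IsPerfectMatching M ∧
       ∀ e ∈ G.cutEdges A, e ∈ M}))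

/-- A brace: a bipartite matching covered graph without nontrivial tight edge-cuts. -/
def IsBrace (H : Multigraph) : Prop :=
  H.Bipartite ∧ H.MatchingCovered ∧
  ∀ A : Set H.V, 2 ≤ A.ncard → 2 ≤ Aᶜ.ncard → ¬ H.IsTightCut A

/-- Data describing a simultaneous gluing of graphs `K w` (through their vertices
`z w`) onto the vertices `w ∈ W` of `H`: the edge `e` of `H` incident with `w`
is identified with the edge `ε w e` of `K w` incident with `z w`, whose other
end is `y w e`. -/
structure GlueData (H : Multigraph) (W : Set H.V) where
  K : W → Multigraph
  z : (w : W) → (K w).V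
  d : (w : W) → {x : (K w).V // x ≠ z w}
  ε : (w : W) → H.E → (K w).E
  y : (w : W) → H.E → {x : (K w).V // x ≠ z w}
  noloop : ∀ (w : W) (e : H.E), H.ends e ≠ Sym2.diag (w : H.V)
  noloopK : ∀ (w : W) (k : (K w).E), (K w).ends k ≠ Sym2.diag (z w)
  ends_eq : ∀ (w : W) (e : H.E), (w : H.V) ∈ H.ends e →
      (K w).ends (ε w e) = s(z w, (y w e : (K w).V))
  inj : ∀ w : W, Set.InjOn (ε w) {e : H.E | (w : H.V) ∈ H.ends e}
  surj : ∀ (w : W) (k : (K w).E), z w ∈ (K w).ends k →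
      ∃ e : H.E, (w : H.V) ∈ H.ends e ∧ ε w e = k

/-- The graph obtained by gluing each `D.K w` through `D.z w` onto the vertex
`w ∈ W` of `H`. -/
def glue (H : Multigraph) (W : Set H.V) (D : GlueData H W) : Multigraph where
  V := {x : H.V // x ∉ W} ⊕ (Σ w : W, {x : (D.K w).V // x ≠ D.z w})
  E := H.E ⊕ (Σ w : W, {k : (D.K w).E // D.z w ∉ (D.K w).ends k})
  ends e :=
    match e with
    | Sum.inl e => (H.ends e).map fun x =>
        if h : x ∈ W then Sum.inr ⟨⟨x, h⟩, D.y ⟨x, h⟩ e⟩ else Sum.inl ⟨x, h⟩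
    | Sum.inr ⟨w, k⟩ => ((D.K w).ends k.1).map fun x =>
        if h : x = D.z w then Sum.inr ⟨w, D.d w⟩ else Sum.inr ⟨w, ⟨x, h⟩⟩

/-- The multiset of vertex degrees different from three. -/
def nonCubicDegrees (G : Multigraph) : Multiset ℕ :=
  ((Finset.univ : Finset G.V).val.map G.degree).filter (· ≠ 3)

/-- `H` is an odd minor of `G`: it is obtained by contracting pairwise disjoint
connected subgraphs, each with an odd number of vertices (deleting arising loops
and keeping parallel edges). -/
def IsOddMinor (G H : Multigraph) : Prop :=
  ∃ π : G.V → H.V, Function.Surjective π ∧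
    (∀ w : H.V, G.ConnectedOn (π ⁻¹' {w}) ∧ Odd (π ⁻¹' {w}).ncard) ∧
    ∃ g : {e : G.E // ∃ u v, G.ends e = s(u, v) ∧ π u ≠ π v} ≃ H.E,
      ∀ e, H.ends (g e) = (G.ends e.1).map π

/-- The 6-vertex graph consisting of two nonadjacent vertices `x = 0`, `y = 1`
and four vertices `a = 2`, `b = 3`, `c = 4`, `d = 5`, with edges `ab`, `cd` and
an edge from each of `a`, `b`, `c`, `d` to each of `x` and `y`. -/
def specialGraph : Multigraph where
  V := Fin 6
  E := Fin 10
  ends := ![s(2, 3), s(4, 5), s(2, 0), s(2, 1), s(3, 0), s(3, 1),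
            s(4, 0), s(4, 1), s(5, 0), s(5, 1)]

/-- The perfect matching polytope: the convex hull of the characteristic vectors
of the perfect matchings. -/
def pmPolytope (G : Multigraph) : Set (G.E → ℝ) :=
  convexHull ℝ {w | ∃ M : Finset G.E, G.IsPerfectMatching M ∧
    w = fun e => if e ∈ M then (1 : ℝ) else 0}

end Multigraph

open Multigraph
namespace Multigraph

lemma inc_of_ends_eq (G : Multigraph) {e : G.E} {a b : G.V} (h : G.ends e = s(a, b)) (v : G.V) :
    G.inc v e = (if v = a then 1 else 0) + (if v = b then 1 else 0) := by
  unfold inc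
  rw [h]
  have : (s(a, b) = Sym2.diag v) ↔ (a = v ∧ b = v) := by
    simp [Sym2.diag]
  rw [if_congr this rfl rfl]
  simp only [Sym2.mem_iff]
  grind

lemma sum_inc_of_ends_eq (G : Multigraph) {e : G.E} {a b : G.V} (h : G.ends e = s(a, b))
    (S : Finset G.V) :
    ∑ v ∈ S, G.inc v e = (if a ∈ S then 1 else 0) + (if b ∈ S then 1 else 0) := by
  simp [G.inc_of_ends_eq h, Finset.sum_add_distrib]

/-- A nonempty vertex set spanning at least as many edges as it has vertices contains a cycle. -/
lemma exists_cycle_of_card_le (G : Multigraph) (S : Finset G.V) (F : Finset G.E)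
    (hS : S.Nonempty) (hF : ∀ e ∈ F, ∀ v ∈ G.ends e, v ∈ S) (hcard : S.card ≤ F.card) :
    ∃ F' ⊆ F, F'.Nonempty ∧ ∀ v : G.V, (∑ e ∈ F', G.inc v e) ≠ 1 := by
  induction S using Finset.strongInduction generalizing F with
  | H S ih =>
    by_cases hall : ∀ v : G.V, (∑ e ∈ F, G.inc v e) ≠ 1
    · exact ⟨F, subset_rfl, Finset.card_pos.mp (hS.card_pos.trans_le hcard), hall⟩
    push Not at hall
    obtain ⟨v, hv⟩ := hall
    obtain ⟨e, he, hne⟩ := Finset.exists_ne_zero_of_sum_ne_zero (hv.trans_ne one_ne_zero)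
    have hsplit := Finset.add_sum_erase F (G.inc v) he
    have hrest : ∀ f ∈ F.erase e, G.inc v f = 0 := Finset.sum_eq_zero_iff.mp (by omega)
    have hinc : G.inc v e = 1 := by omega
    obtain ⟨⟨a, b⟩, hab⟩ := Sym2.mk_surjective (G.ends e)
    have hab' : G.ends e = s(a, b) := hab.symm
    have haS : a ∈ S := hF e he a (by simp [hab'])
    have hbS : b ∈ S := hF e he b (by simp [hab'])
    rw [G.inc_of_ends_eq hab'] at hinc
    have hvS : v ∈ S := by grind
    have hne' : (S.erase v).Nonempty := by
      by_cases hva : v = a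
      · exact ⟨b, by grind⟩
      · exact ⟨a, by grind⟩
    obtain ⟨F', hsub, h⟩ := ih (S.erase v) (Finset.erase_ssubset hvS) (F.erase e) hne'
      (by
        intro f hf w hw
        refine Finset.mem_erase.mpr ⟨?_, hF f (Finset.mem_of_mem_erase hf) w hw⟩
        rintro rfl
        have h0 := hrest f hf
        unfold inc at h0
        split_ifs at h0)
      (by
        rw [Finset.card_erase_of_mem hvS, Finset.card_erase_of_mem he]
        omega)
    exact ⟨F', hsub.trans (Finset.erase_subset _ _), h⟩

lemma cutEdges_compl (G : Multigraph) (A : Set G.V) : G.cutEdges Aᶜ = G.cutEdges A := by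
  ext e
  constructor
  · rintro ⟨u, v, h, hu, hv⟩
    exact ⟨v, u, h.trans Sym2.eq_swap, not_not.mp hv, hu⟩
  · rintro ⟨u, v, h, hu, hv⟩
    exact ⟨v, u, h.trans Sym2.eq_swap, hv, not_not.mpr hu⟩

/-- The degree sum over `S` is at most twice the number of edges inside `S` plus the number of
edges leaving `S`. -/
lemma sum_degree_le (G : Multigraph) (S : Finset G.V) :
    ∑ v ∈ S, G.degree v ≤
      2 * (Finset.univ.filter fun e => ∀ v ∈ G.ends e, v ∈ S).card +
        (G.cutEdges (S : Set G.V)).ncard := by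
  have hcut : (G.cutEdges (S : Set G.V)).ncard =
      ∑ e : G.E, if e ∈ G.cutEdges (S : Set G.V) then 1 else 0 := by
    rw [Set.ncard_eq_toFinset_card', Finset.sum_boole]
    simp [Set.toFinset]
  rw [hcut, Finset.card_filter, Finset.mul_sum, ← Finset.sum_add_distrib]
  unfold degree
  rw [Finset.sum_comm]
  refine Finset.sum_le_sum fun e _ => ?_
  obtain ⟨⟨a, b⟩, hab⟩ := Sym2.mk_surjective (G.ends e)
  have hab' : G.ends e = s(a, b) := hab.symm
  rw [G.sum_inc_of_ends_eq hab']
  have hin : (∀ v ∈ G.ends e, v ∈ S) ↔ a ∈ S ∧ b ∈ S := by simp [hab']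
  have hl : a ∈ S → b ∉ S → e ∈ G.cutEdges (S : Set G.V) := fun ha hb =>
    ⟨a, b, hab', by simpa using ha, by simpa using hb⟩
  have hr : b ∈ S → a ∉ S → e ∈ G.cutEdges (S : Set G.V) := fun hb ha =>
    ⟨b, a, hab'.trans Sym2.eq_swap, by simpa using hb, by simpa using ha⟩
  rw [if_congr hin rfl rfl]
  by_cases ha : a ∈ S <;> by_cases hb : b ∈ S <;> simp [ha, hb, hl, hr]

lemma hasCycleWithin_of_ncard_cutEdges_le (G : Multigraph)
    (hdeg : ∀ v : G.V, 3 ≤ G.degree v) (A : Set G.V) (hA : A.Nonempty)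
    (hcut : (G.cutEdges A).ncard - 1 ≤ A.ncard) : G.HasCycleWithin A := by
  obtain ⟨S, rfl⟩ : ∃ S : Finset G.V, (S : Set G.V) = A := ⟨A.toFinset, by simp⟩
  rw [Set.ncard_coe_finset] at hcut
  have hle := G.sum_degree_le S
  have hge : S.card * 3 ≤ ∑ v ∈ S, G.degree v := by
    simpa using Finset.card_nsmul_le_sum S G.degree 3 fun v _ => hdeg v
  obtain ⟨F, hsub, hne, h⟩ := G.exists_cycle_of_card_le S
    (Finset.univ.filter fun e => ∀ v ∈ G.ends e, v ∈ S) (by simpa using hA)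
    (fun e he => (Finset.mem_filter.mp he).2) (by omega)
  exact ⟨F, hne, fun e he v hv => by simpa using (Finset.mem_filter.mp (hsub he)).2 v hv, h⟩

end Multigraph

/-- Let `G` be a graph with minimum degree three and let
`E(A, B)` be a `k`-edge-cut with `|A| ≥ k - 1` and `|B| ≥ k - 1`. Then `E(A, B)`
is a cyclic edge-cut: both `G[A]` and `G[B]` contain a cycle. -/
theorem bigSides_cut_is_cyclic (G : Multigraph)
    (hdeg : ∀ v : G.V, 3 ≤ G.degree v) (k : ℕ) (A : Set G.V)
    (hA : A.Nonempty) (hB : Aᶜ.Nonempty)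
    (hcut : (G.cutEdges A).ncard = k)
    (hAk : k - 1 ≤ A.ncard) (hBk : k - 1 ≤ Aᶜ.ncard) :
    G.HasCycleWithin A ∧ G.HasCycleWithin Aᶜ := by
  subst hcut
  exact ⟨G.hasCycleWithin_of_ncard_cutEdges_le hdeg A hA hAk,
    G.hasCycleWithin_of_ncard_cutEdges_le hdeg Aᶜ hB (by rwa [G.cutEdges_compl])⟩
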